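/- arXiv:1506.01314 — 9 statements merged into one kernel-verified Lean document; each statement's English description precedes it below -/
import Mathlib

section
/- Let α, β, γ ∈ {0, 1} ⊆ B and define f : B² → B by f(x, y) = x·y + α·x + β·y + γ (an arbitrary non-linear binary term function of B). If a bijection φ : B → B preserves f, then φ is a Boolean automorphism of B. -/
open scoped symmDiff

/-- `B` is atomless: below every nonzero element there is a strictly smaller nonzero element. -/
def Atomless (B : Type*) [Preorder B] [OrderBot B] : Prop :=
  ∀ a : B, ⊥ < a → ∃ b : B, ⊥ < b ∧ b < a

/-- A Boolean automorphism: a bijection preserving meet, join and complement. -/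
def IsBoolAut {B : Type*} [BooleanAlgebra B] (φ : B → B) : Prop :=
  Function.Bijective φ ∧ (∀ x y, φ (x ⊓ y) = φ x ⊓ φ y) ∧
    (∀ x y, φ (x ⊔ y) = φ x ⊔ φ y) ∧ (∀ x, φ xᶜ = (φ x)ᶜ)

/-- An order automorphism of a Boolean algebra is a Boolean automorphism. -/
theorem OrderIso.isBoolAut {B : Type*} [BooleanAlgebra B] (e : B ≃o B) : IsBoolAut e :=
  ⟨e.bijective, map_inf e, map_sup e, map_compl' e⟩

/-- A bijection of a Boolean algebra preserving meets is a Boolean automorphism. -/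
theorem isBoolAut_of_map_inf {B : Type*} [BooleanAlgebra B] {φ : B → B}
    (hbij : Function.Bijective φ) (h : ∀ x y, φ (x ⊓ y) = φ x ⊓ φ y) : IsBoolAut φ :=
  OrderIso.isBoolAut
    { toEquiv := Equiv.ofBijective φ hbij
      map_rel_iff' := fun {a b} => by
        simp only [Equiv.ofBijective_apply, ← inf_eq_left, ← h, hbij.injective.eq_iff] }

/-- A bijection of a Boolean algebra preserving joins is a Boolean automorphism. -/
theorem isBoolAut_of_map_sup {B : Type*} [BooleanAlgebra B] {φ : B → B}
    (hbij : Function.Bijective φ) (h : ∀ x y, φ (x ⊔ y) = φ x ⊔ φ y) : IsBoolAut φ :=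
  OrderIso.isBoolAut
    { toEquiv := Equiv.ofBijective φ hbij
      map_rel_iff' := fun {a b} => by
        simp only [Equiv.ofBijective_apply, ← sup_eq_right, ← h, hbij.injective.eq_iff] }

theorem inf_symmDiff_left_eq_sdiff {B : Type*} [BooleanAlgebra B] (x y : B) :
    (x ⊓ y) ∆ x = x \ y := by
  rw [symmDiff_of_le inf_le_left, sdiff_inf_self_left]

theorem inf_symmDiff_right_eq_sdiff {B : Type*} [BooleanAlgebra B] (x y : B) :
    (x ⊓ y) ∆ y = y \ x := by
  rw [symmDiff_of_le inf_le_right, sdiff_inf_self_right]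

/-- If a bijection of the countable atomless Boolean algebra `B` preserves a non-linear
binary term function `f(x,y) = x·y + α·x + β·y + γ` (ring operations: `+` is symmetric
difference, `·` is meet, `0 = ⊥`, `1 = ⊤`, `α, β, γ ∈ {0,1}`), then it is a Boolean
automorphism. -/
theorem nonlinear_binary_preserving_is_aut
    (B : Type*) [BooleanAlgebra B] [Countable B] [Nontrivial B] (hAtomless : Atomless B)
    (α β γ : B) (hα : α = ⊥ ∨ α = ⊤) (hβ : β = ⊥ ∨ β = ⊤) (hγ : γ = ⊥ ∨ γ = ⊤)
    (f : B → B → B) (hf : ∀ x y, f x y = (x ⊓ y) ∆ ((α ⊓ x) ∆ ((β ⊓ y) ∆ γ)))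
    (φ : B → B) (hbij : Function.Bijective φ)
    (hpres : ∀ x y, φ (f x y) = f (φ x) (φ y)) :
    IsBoolAut φ := by
  simp only [← symmDiff_assoc] at hf
  rcases hα with rfl | rfl <;> rcases hβ with rfl | rfl <;> rcases hγ with rfl | rfl <;>
    simp only [bot_inf_eq, top_inf_eq, symmDiff_bot, symmDiff_top, inf_symmDiff_left_eq_sdiff,
      inf_symmDiff_right_eq_sdiff, sdiff_symmDiff_eq_sup] at hf
  · have key : ∀ x y, x ⊓ y = f x y := fun x y => by
      simp [hf]
    exact isBoolAut_of_map_inf hbij fun x y => by simp only [key, hpres]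
  · have key : ∀ x y, x ⊓ y = f (f x y) (f x y) := fun x y => by
      simp [hf]
    exact isBoolAut_of_map_inf hbij fun x y => by simp only [key, hpres]
  · have key : ∀ x y, x ⊓ y = f (f y x) x := fun x y => by
      simp [hf, sdiff_eq, inf_sup_left]
    exact isBoolAut_of_map_inf hbij fun x y => by simp only [key, hpres]
  · have key : ∀ x y, x ⊔ y = f y (f y x) := fun x y => by
      simp [hf, sdiff_eq, sup_inf_left, sup_comm]
    exact isBoolAut_of_map_sup hbij fun x y => by simp only [key, hpres]
  · have key : ∀ x y, x ⊓ y = f x (f x y) := fun x y => by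
      simp [hf, sdiff_eq, inf_sup_left]
    exact isBoolAut_of_map_inf hbij fun x y => by simp only [key, hpres]
  · have key : ∀ x y, x ⊔ y = f (f x y) y := fun x y => by
      simp [hf, sdiff_eq, sup_inf_left, sup_comm]
    exact isBoolAut_of_map_sup hbij fun x y => by simp only [key, hpres]
  · have key : ∀ x y, x ⊔ y = f x y := fun x y => by
      simp [hf]
    exact isBoolAut_of_map_sup hbij fun x y => by simp only [key, hpres]
  · have key : ∀ x y, x ⊔ y = f (f x y) (f x y) := fun x y => by
      simp [hf]
    exact isBoolAut_of_map_sup hbij fun x y => by simp only [key, hpres]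
end

section
/- Let α₀, α₁, …, α₇ ∈ {0, 1} ⊆ B with at least one of α₄, α₅, α₆, α₇ equal to 1, and define f : B³ → B by f(x, y, z) = α₇·xyz + α₆·xy + α₅·yz + α₄·zx + α₃·x + α₂·y + α₁·z + α₀. If a bijection φ : B → B preserves f, then either φ is a Boolean automorphism of B, or there exist c ∈ B with c ≠ 0 and a Boolean automorphism ψ of B such that φ(x) = ψ(x) + c for all x ∈ B. -/
open scoped symmDiff

/-! ### Maps of a Boolean ring preserving a non-affine function -/

theorem map_eq_of_eq {R : Type*} {φ : R → R} {p q r s : R}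
    (h : φ p = r) (hp : p = q) (hr : r = s) : φ q = s :=
  hp ▸ h.trans hr

section BooleanRing

variable {R : Type*} [BooleanRing R] {φ : R → R}

/-- A map preserves the meet, the join, or, after a translation fixing `0`, the meet of a
Boolean ring. -/
def PreservesMeetJoinOrTranslate (φ : R → R) : Prop :=
  (∀ x y, φ (x * y) = φ x * φ y) ∨
    (∀ x y, φ (x + y + x * y) = φ x + φ y + φ x * φ y) ∨
    ∀ x y, φ (x * y) + φ 0 = (φ x + φ 0) * (φ y + φ 0)

theorem preservesMeetJoinOrTranslate_of_binary {a b c : R}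
    (ha : a = 0 ∨ a = 1) (hb : b = 0 ∨ b = 1) (hc : c = 0 ∨ c = 1)
    (h : ∀ x y, φ (x * y + a * x + b * y + c) = φ x * φ y + a * φ x + b * φ y + c) :
    PreservesMeetJoinOrTranslate φ := by
  have two : (1 : R) + 1 = 0 := BooleanRing.add_self 1
  have sq (x : R) : x * x = x := BooleanRing.mul_self x
  have comp_self (x y : R) := (h (x * y + a * x + b * y + c) (x * y + a * x + b * y + c)).trans
    (by rw [h x y])
  have comp_left (x y : R) := (h (x * y + a * x + b * y + c) y).trans (by rw [h x y])
  have comp_right (x y : R) := (h x (x * y + a * x + b * y + c)).trans (by rw [h x y])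
  rcases ha with rfl | rfl <;> rcases hb with rfl | rfl <;> rcases hc with rfl | rfl
  · exact Or.inl fun x y => map_eq_of_eq (h x y) (by grind) (by grind)
  · exact Or.inl fun x y => map_eq_of_eq (comp_self x y)
      (by grind [sq x, sq y]) (by grind [sq (φ x), sq (φ y)])
  · exact Or.inl fun x y => map_eq_of_eq (comp_left x y)
      (by grind [sq x, sq y]) (by grind [sq (φ x), sq (φ y)])
  · exact Or.inr <| Or.inl fun x y => map_eq_of_eq (comp_right x y)
      (by grind [sq x, sq y]) (by grind [sq (φ x), sq (φ y)])
  · exact Or.inl fun x y => map_eq_of_eq (comp_right x y)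
      (by grind [sq x, sq y]) (by grind [sq (φ x), sq (φ y)])
  · exact Or.inr <| Or.inl fun x y => map_eq_of_eq (comp_left x y)
      (by grind [sq x, sq y]) (by grind [sq (φ x), sq (φ y)])
  · exact Or.inr <| Or.inl fun x y => map_eq_of_eq (h x y) (by grind) (by grind)
  · exact Or.inr <| Or.inl fun x y => map_eq_of_eq (comp_self x y)
      (by grind [sq x, sq y]) (by grind [sq (φ x), sq (φ y)])

theorem preservesMeetJoinOrTranslate_of_median
    (h : ∀ x y z, φ (x * y + y * z + z * x) = φ x * φ y + φ y * φ z + φ z * φ x) :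
    PreservesMeetJoinOrTranslate φ :=
  Or.inr <| Or.inr fun x y => by
    have h1 : φ (x * y) = φ x * φ y + φ y * φ 0 + φ 0 * φ x :=
      map_eq_of_eq (h x y 0) (by ring) rfl
    rw [h1]
    linear_combination -BooleanRing.mul_self (φ 0)

/-- The median with its last argument negated. -/
theorem preservesMeetJoinOrTranslate_of_median_add
    (h : ∀ x y z, φ (x * y + y * z + z * x + x + y) =
      φ x * φ y + φ y * φ z + φ z * φ x + φ x + φ y) :
    PreservesMeetJoinOrTranslate φ := by
  have two : (1 : R) + 1 = 0 := BooleanRing.add_self 1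
  have sq (x : R) : x * x = x := BooleanRing.mul_self x
  exact preservesMeetJoinOrTranslate_of_median fun x y z =>
    map_eq_of_eq ((h x y (x * y + y * z + z * x + x + y)).trans (by rw [h x y z]))
      (by grind [sq x, sq y, sq z]) (by grind [sq (φ x), sq (φ y), sq (φ z)])

theorem preservesMeetJoinOrTranslate_of_median_linear {b c d e : R}
    (hb : b = 0 ∨ b = 1) (hc : c = 0 ∨ c = 1) (hd : d = 0 ∨ d = 1) (he : e = 0 ∨ e = 1)
    (h : ∀ x y z, φ (x * y + y * z + z * x + b * x + c * y + d * z + e) =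
      φ x * φ y + φ y * φ z + φ z * φ x + b * φ x + c * φ y + d * φ z + e) :
    PreservesMeetJoinOrTranslate φ := by
  have two : (1 : R) + 1 = 0 := BooleanRing.add_self 1
  have sq (x : R) : x * x = x := BooleanRing.mul_self x
  have parity : b + c + d = 0 ∨ b + c + d = 1 := by grind
  have diag (x : R) : φ ((1 + (b + c + d)) * x + e) = (1 + (b + c + d)) * φ x + e :=
    map_eq_of_eq (h x x x) (by grind [sq x]) (by grind [sq (φ x)])
  rcases parity with hp | hp
  · have hneg (x : R) : φ (x + e) = φ x + e := by simpa [hp] using diag x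
    have h' (x y z : R) : φ (x * y + y * z + z * x + b * x + c * y + d * z) =
        φ x * φ y + φ y * φ z + φ z * φ x + b * φ x + c * φ y + d * φ z :=
      add_right_cancel ((hneg _).symm.trans (h x y z))
    have hd' : d = b + c := by grind
    subst hd'
    rcases hb with rfl | rfl <;> rcases hc with rfl | rfl
    · exact preservesMeetJoinOrTranslate_of_median fun x y z =>
        map_eq_of_eq (h' x y z) (by grind) (by grind)
    · exact preservesMeetJoinOrTranslate_of_median_add fun x y z =>
        map_eq_of_eq (h' z x y) (by grind) (by grind)
    · exact preservesMeetJoinOrTranslate_of_median_add fun x y z =>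
        map_eq_of_eq (h' x z y) (by grind) (by grind)
    · exact preservesMeetJoinOrTranslate_of_median_add fun x y z =>
        map_eq_of_eq (h' x y z) (by grind) (by grind)
  · have hconst : φ e = e := by simpa [hp, two] using diag 0
    refine preservesMeetJoinOrTranslate_of_binary (a := e + c) (b := e + d) (c := b * e + e)
      (by grind) (by grind) (by grind) fun x y => ?_
    exact map_eq_of_eq ((h e x y).trans (by rw [hconst])) (by ring) (by ring)

theorem preservesMeetJoinOrTranslate_of_ternary {α₀ α₁ α₂ α₃ α₄ α₅ α₆ α₇ : R}
    (h₀ : α₀ = 0 ∨ α₀ = 1) (h₁ : α₁ = 0 ∨ α₁ = 1) (h₂ : α₂ = 0 ∨ α₂ = 1)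
    (h₃ : α₃ = 0 ∨ α₃ = 1) (h₄ : α₄ = 0 ∨ α₄ = 1) (h₅ : α₅ = 0 ∨ α₅ = 1)
    (h₆ : α₆ = 0 ∨ α₆ = 1) (h₇ : α₇ = 0 ∨ α₇ = 1)
    (hnl : α₄ = 1 ∨ α₅ = 1 ∨ α₆ = 1 ∨ α₇ = 1) {f : R → R → R → R}
    (hf : ∀ x y z, f x y z = α₇ * (x * y * z) + (α₆ * (x * y) + (α₅ * (y * z) +
      (α₄ * (z * x) + (α₃ * x + (α₂ * y + (α₁ * z + α₀)))))))
    (h : ∀ x y z, φ (f x y z) = f (φ x) (φ y) (φ z)) :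
    PreservesMeetJoinOrTranslate φ := by
  have sq (x : R) : x * x = x := BooleanRing.mul_self x
  have add01 {a b : R} (ha : a = 0 ∨ a = 1) (hb : b = 0 ∨ b = 1) : a + b = 0 ∨ a + b = 1 := by
    have two : (1 : R) + 1 = 0 := BooleanRing.add_self 1
    grind
  simp only [hf] at h
  rcases add01 (add01 h₇ h₅) h₄ with hxy | hxy
  swap
  · refine preservesMeetJoinOrTranslate_of_binary (add01 (add01 h₆ h₃) h₂) h₁ h₀ fun x z =>
      map_eq_of_eq (h x x z) ?_ ?_
    · linear_combination x * z * hxy + (α₇ * z + α₆) * sq x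
    · linear_combination φ x * φ z * hxy + (α₇ * φ z + α₆) * sq (φ x)
  rcases add01 (add01 h₇ h₆) h₄ with hyz | hyz
  swap
  · refine preservesMeetJoinOrTranslate_of_binary h₃ (add01 (add01 h₅ h₂) h₁) h₀ fun x y =>
      map_eq_of_eq (h x y y) ?_ ?_
    · linear_combination x * y * hyz + (α₇ * x + α₅) * sq y
    · linear_combination φ x * φ y * hyz + (α₇ * φ x + α₅) * sq (φ y)
  rcases add01 (add01 h₇ h₆) h₅ with hzx | hzx
  swap
  · refine preservesMeetJoinOrTranslate_of_binary (add01 (add01 h₄ h₃) h₁) h₂ h₀ fun x y =>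
      map_eq_of_eq (h x y x) ?_ ?_
    · linear_combination x * y * hzx + (α₇ * y + α₄) * sq x
    · linear_combination φ x * φ y * hzx + (α₇ * φ y + α₄) * sq (φ x)
  have e₅ : α₅ = α₄ := by linear_combination hzx - hyz
  have e₆ : α₆ = α₄ := by linear_combination hzx - hxy
  have e₇ : α₇ = 0 := by linear_combination hxy - e₅ - BooleanRing.add_self α₄
  have e₄ : α₄ = 1 := by grind
  subst e₅ e₆ e₇ e₄
  exact preservesMeetJoinOrTranslate_of_median_linear h₃ h₂ h₁ h₀ fun x y z =>
    map_eq_of_eq (h x y z) (by ring) (by ring)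

end BooleanRing

/-- If a bijection of the countable atomless Boolean algebra `B` preserves a non-linear
ternary term function
`f(x,y,z) = α₇·xyz + α₆·xy + α₅·yz + α₄·zx + α₃·x + α₂·y + α₁·z + α₀`
(ring operations: `+` is symmetric difference, `·` is meet, `0 = ⊥`, `1 = ⊤`, all
coefficients in `{0,1}` and at least one of `α₄,α₅,α₆,α₇` equal to `1`), then it is either
a Boolean automorphism, or the composition of a Boolean automorphism followed by a
non-identical translation. -/
theorem nonlinear_ternary_preserving_aut_or_translate
    (B : Type*) [BooleanAlgebra B] [Countable B] [Nontrivial B] (hAtomless : Atomless B)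
    (α₀ α₁ α₂ α₃ α₄ α₅ α₆ α₇ : B)
    (h₀ : α₀ = ⊥ ∨ α₀ = ⊤) (h₁ : α₁ = ⊥ ∨ α₁ = ⊤) (h₂ : α₂ = ⊥ ∨ α₂ = ⊤)
    (h₃ : α₃ = ⊥ ∨ α₃ = ⊤) (h₄ : α₄ = ⊥ ∨ α₄ = ⊤) (h₅ : α₅ = ⊥ ∨ α₅ = ⊤)
    (h₆ : α₆ = ⊥ ∨ α₆ = ⊤) (h₇ : α₇ = ⊥ ∨ α₇ = ⊤)
    (hnl : α₄ = ⊤ ∨ α₅ = ⊤ ∨ α₆ = ⊤ ∨ α₇ = ⊤)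
    (f : B → B → B → B)
    (hf : ∀ x y z, f x y z =
      (α₇ ⊓ (x ⊓ y ⊓ z)) ∆ ((α₆ ⊓ (x ⊓ y)) ∆ ((α₅ ⊓ (y ⊓ z)) ∆ ((α₄ ⊓ (z ⊓ x)) ∆
        ((α₃ ⊓ x) ∆ ((α₂ ⊓ y) ∆ ((α₁ ⊓ z) ∆ α₀)))))))
    (φ : B → B) (hbij : Function.Bijective φ)
    (hpres : ∀ x y z, φ (f x y z) = f (φ x) (φ y) (φ z)) :
    IsBoolAut φ ∨
      ∃ (c : B) (ψ : B → B), c ≠ ⊥ ∧ IsBoolAut ψ ∧ ∀ x, φ x = ψ x ∆ c := by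
  let : BooleanRing B := BooleanAlgebra.toBooleanRing
  have sup_eq (x y : B) : x ⊔ y = x + y + x * y := (symmDiff_symmDiff_inf x y).symm
  rcases preservesMeetJoinOrTranslate_of_ternary h₀ h₁ h₂ h₃ h₄ h₅ h₆ h₇ hnl hf hpres with
    h | h | h
  · exact Or.inl (isBoolAut_of_map_inf hbij h)
  · exact Or.inl (isBoolAut_of_map_sup hbij fun x y => by simpa only [sup_eq] using h x y)
  · have hψ : IsBoolAut fun x => φ x ∆ φ ⊥ :=
      isBoolAut_of_map_inf ((symmDiff_left_involutive (φ ⊥)).bijective.comp hbij) h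
    by_cases h0 : φ ⊥ = ⊥
    · left
      simpa only [h0, symmDiff_bot] using hψ
    · exact Or.inr ⟨φ ⊥, _, h0, hψ, fun x => (symmDiff_symmDiff_cancel_right _ _).symm⟩
end

section
/- A bijection φ : B → B preserves the median M if and only if there exist c ∈ B and a Boolean automorphism ψ of B such that φ(x) = ψ(x) + c for all x ∈ B. -/
open scoped symmDiff

/-- The median function `M(x,y,z) = x·y + y·z + z·x` on a Boolean algebra,
written with symmetric difference as `+` and meet as `·`. -/
def median {B : Type*} [BooleanAlgebra B] (x y z : B) : B :=
  (x ⊓ y) ∆ ((y ⊓ z) ∆ (z ⊓ x))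

section Median

variable {B : Type*} [BooleanAlgebra B]

/-- The median commutes with translations. -/
theorem median_symmDiff_right (x y z c : B) :
    median (x ∆ c) (y ∆ c) (z ∆ c) = median x y z ∆ c := by
  apply toBoolRing.injective
  simp only [median, toBoolRing_symmDiff, toBoolRing_inf]
  generalize toBoolRing x = x, toBoolRing y = y, toBoolRing z = z, toBoolRing c = c
  linear_combination (3 : AsBoolRing B) * BooleanRing.mul_self c +
    BooleanRing.add_self (x * c + y * c + z * c + c)

theorem median_bot_right (x y : B) : median x y ⊥ = x ⊓ y := by
  simp [median]

theorem median_top_right (x y : B) : median x y ⊤ = x ⊔ y := by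
  rw [median, inf_top_eq, top_inf_eq, symmDiff_comm, symmDiff_comm y x, symmDiff_symmDiff_inf]

/-- A Boolean automorphism preserves symmetric differences. -/
theorem IsBoolAut.map_symmDiff {ψ : B → B} (hψ : IsBoolAut ψ) (x y : B) :
    ψ (x ∆ y) = ψ x ∆ ψ y := by
  obtain ⟨-, hinf, hsup, hcompl⟩ := hψ
  simp only [symmDiff_eq, hinf, hsup, hcompl]

/-- A Boolean automorphism preserves medians. -/
theorem IsBoolAut.map_median {ψ : B → B} (hψ : IsBoolAut ψ) (x y z : B) :
    ψ (median x y z) = median (ψ x) (ψ y) (ψ z) := by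
  simp only [median, hψ.map_symmDiff, hψ.2.1]

/-- A median-preserving bijection fixing `⊥` is a Boolean automorphism. -/
theorem isBoolAut_of_map_median {ψ : B → B} (hbij : Function.Bijective ψ)
    (hmed : ∀ x y z, ψ (median x y z) = median (ψ x) (ψ y) (ψ z)) (hbot : ψ ⊥ = ⊥) :
    IsBoolAut ψ := by
  have hinf (x y : B) : ψ (x ⊓ y) = ψ x ⊓ ψ y := by
    rw [← median_bot_right, hmed, hbot, median_bot_right]
  have htop : ψ ⊤ = ⊤ := by
    obtain ⟨t, ht⟩ := hbij.surjective ⊤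
    simpa [ht] using (hinf t ⊤).symm
  have hsup (x y : B) : ψ (x ⊔ y) = ψ x ⊔ ψ y := by
    rw [← median_top_right, hmed, htop, median_top_right]
  refine ⟨hbij, hinf, hsup, fun x => (IsCompl.compl_eq (.of_eq ?_ ?_)).symm⟩
  · rw [← hinf, inf_compl_self, hbot]
  · rw [← hsup, sup_compl_eq_top, htop]

end Median

/-- A bijection of the countable atomless Boolean algebra `B` preserves the median
`M(x,y,z) = x·y + y·z + z·x` if and only if it is the composition of a Boolean
automorphism followed by a translation `x ↦ x + c`. -/
theorem preserves_median_iff_translate_of_aut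
    (B : Type*) [BooleanAlgebra B] [Countable B] [Nontrivial B] (hAtomless : Atomless B)
    (φ : B → B) (hbij : Function.Bijective φ) :
    (∀ x y z, φ (median x y z) = median (φ x) (φ y) (φ z)) ↔
      ∃ (c : B) (ψ : B → B), IsBoolAut ψ ∧ ∀ x, φ x = ψ x ∆ c := by
  constructor
  · intro hmed
    refine ⟨φ ⊥, fun x => φ x ∆ φ ⊥, isBoolAut_of_map_median ?_ ?_ (symmDiff_self _), fun x => ?_⟩
    · exact (symmDiff_left_involutive (φ ⊥)).bijective.comp hbij
    · intro x y z
      rw [hmed, median_symmDiff_right]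
    · rw [symmDiff_symmDiff_cancel_right]
  · rintro ⟨c, ψ, hψ, hφ⟩ x y z
    simp only [hφ, median_symmDiff_right, hψ.map_median]
end

section
/- Let f : Bᵏ → B be a non-linear term function of B. Then there exists a non-linear term function g of B of arity at most 3 such that every bijection φ : B → B that preserves f also preserves g. -/
open scoped symmDiff

/-- The term function of arity `k` determined by a set `S` of monomials: the iterated
symmetric difference, over `ε ∈ S`, of the meets `Π_{i ∈ ε} x i` (empty meet is `⊤ = 1`,
empty sum is `⊥ = 0`). -/
def termFun {B : Type*} [BooleanAlgebra B] {k : ℕ} (S : Finset (Finset (Fin k)))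
    (x : Fin k → B) : B :=
  S.fold (· ∆ ·) ⊥ fun ε => ε.inf x

/-- `f` is a non-linear term function: it is given by a set `S` of monomials, one of which
has degree at least `2`. -/
def IsNonLinearTermFun {B : Type*} [BooleanAlgebra B] {k : ℕ} (f : (Fin k → B) → B) : Prop :=
  ∃ S : Finset (Finset (Fin k)), (∀ x, f x = termFun S x) ∧ ∃ ε ∈ S, 2 ≤ ε.card

/-- A bijection `φ` preserves a `k`-ary function `f` if `φ (f x₁ … x_k) = f (φ x₁) … (φ x_k)`. -/
def Preserves {B : Type*} {k : ℕ} (φ : B → B) (f : (Fin k → B) → B) : Prop :=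
  ∀ x : Fin k → B, φ (f x) = f fun i => φ (x i)

/-- Toggling membership of the monomial `a` adds it to the term function. -/
theorem termFun_symmDiff_singleton {B : Type*} [BooleanAlgebra B] {k : ℕ}
    (S : Finset (Finset (Fin k))) (a : Finset (Fin k)) (x : Fin k → B) :
    termFun (S ∆ {a}) x = a.inf x ∆ termFun S x := by
  by_cases ha : a ∈ S
  · have h₁ : S ∆ {a} = S.erase a := by
      ext e; simp only [Finset.mem_symmDiff, Finset.mem_singleton, Finset.mem_erase]; grind
    have h₂ : termFun S x = a.inf x ∆ termFun (S.erase a) x := by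
      conv_lhs => rw [← Finset.insert_erase ha]
      exact Finset.fold_insert (Finset.notMem_erase a S)
    rw [h₁, h₂, symmDiff_symmDiff_cancel_left]
  · have h₁ : S ∆ {a} = insert a S := by
      ext e; simp only [Finset.mem_symmDiff, Finset.mem_singleton, Finset.mem_insert]; grind
    rw [h₁]
    exact Finset.fold_insert ha

/-- Identifying variables along `c` gives the term function whose monomials are those that
arise as an image under `c` an odd number of times. -/
theorem exists_termFun_comp (B : Type*) [BooleanAlgebra B] {k m : ℕ} (c : Fin k → Fin m)
    (S : Finset (Finset (Fin k))) :
    ∃ T : Finset (Finset (Fin m)),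
      (∀ x : Fin m → B, termFun S (x ∘ c) = termFun T x) ∧
      ∀ e, e ∈ T ↔ Odd (S.filter fun d => d.image c = e).card := by
  induction S using Finset.induction_on with
  | empty => exact ⟨∅, fun x => rfl, by simp⟩
  | insert a S ha ih =>
    obtain ⟨T, hT, hmem⟩ := ih
    refine ⟨T ∆ {a.image c}, fun x => ?_, fun e => ?_⟩
    · rw [termFun_symmDiff_singleton, ← hT, Finset.inf_image]
      exact Finset.fold_insert ha
    · rw [Finset.filter_insert, Finset.mem_symmDiff, Finset.mem_singleton, hmem]
      by_cases he : a.image c = e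
      · rw [if_pos he, Finset.card_insert_of_notMem (by simp [ha]), Nat.odd_add_one]
        simp [he]
      · rw [if_neg he]
        simp [Ne.symm he]

/-- A non-linear set of monomials stays non-linear under some identification of its
variables down to three. -/
theorem exists_nonlinear_minor {k : ℕ} (S : Finset (Finset (Fin k)))
    (hS : ∃ ε ∈ S, 2 ≤ ε.card) :
    ∃ (c : Fin k → Fin 3) (e : Finset (Fin 3)), 2 ≤ e.card ∧
      Odd (S.filter fun d => d.image c = e).card := by
  obtain ⟨a, ha⟩ := hS
  obtain ⟨ε, -, hε⟩ := (S.filter fun d => 2 ≤ d.card).exists_le_minimal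
    (a := a) (by simpa using ha)
  obtain ⟨hεS, hcard⟩ := Finset.mem_filter.1 hε.prop
  obtain ⟨i, hi, j, hj, hij⟩ := Finset.one_lt_card.1 hcard
  let c : Fin k → Fin 3 := fun l =>
    if l = i then 0 else if l ∈ ε then 1 else 2
  have hc : ∀ l, c l = 2 ↔ l ∉ ε := by
    intro l
    simp only [c]
    split_ifs <;> simp_all
  have himage : 2 ≤ (ε.image c).card := by
    refine Finset.one_lt_card.2 ⟨c i, Finset.mem_image_of_mem c hi, c j,
      Finset.mem_image_of_mem c hj, ?_⟩
    simp [c, hij.symm, hj]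
  refine ⟨c, ε.image c, himage, ?_⟩
  have hfilter : (S.filter fun d => d.image c = ε.image c) = {ε} := by
    ext d
    rw [Finset.mem_filter, Finset.mem_singleton]
    refine ⟨fun ⟨hdS, hd⟩ => ?_, fun h => by subst h; exact ⟨hεS, rfl⟩⟩
    have hsub : d ⊆ ε := by
      intro l hl
      obtain ⟨l', hl', h⟩ := Finset.mem_image.1 (hd ▸ Finset.mem_image_of_mem c hl)
      by_contra hlε
      exact (hc l').1 (h.trans ((hc l).2 hlε)) hl'
    refine hε.eq_of_le (Finset.mem_filter.2 ⟨hdS, ?_⟩) hsub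
    exact (hd ▸ himage).trans Finset.card_image_le
  simp [hfilter]

/-- For every non-linear term function `f` of the countable atomless Boolean algebra `B`
there is a non-linear term function `g` of arity at most `3` such that every bijection
preserving `f` also preserves `g`. -/
theorem nonlinear_term_reduces_to_arity_le_three
    (B : Type*) [BooleanAlgebra B] [Countable B] [Nontrivial B] (hAtomless : Atomless B)
    {k : ℕ} (f : (Fin k → B) → B) (hf : IsNonLinearTermFun f) :
    ∃ (m : ℕ) (g : (Fin m → B) → B), m ≤ 3 ∧ IsNonLinearTermFun g ∧
      ∀ φ : B → B, Function.Bijective φ → Preserves φ f → Preserves φ g := by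
  obtain ⟨S, hfS, hS⟩ := hf
  obtain ⟨c, e, he, hodd⟩ := exists_nonlinear_minor S hS
  obtain ⟨T, hT, hTmem⟩ := exists_termFun_comp B c S
  exact ⟨3, fun x => f (x ∘ c), le_rfl,
    ⟨T, fun x => (hfS _).trans (hT x), e, (hTmem e).2 hodd, he⟩, fun φ _ hφ x => hφ _⟩
end

section
/- Let f : Bᵏ → B be a term function of B such that f(x₁ + 1, x₂ + 1, …, x_k + 1) = f(x₁, …, x_k) + 1 for all x₁, …, x_k ∈ B. Then for every c ∈ B, f(x₁ + c, x₂ + c, …, x_k + c) = f(x₁, …, x_k) + c for all x₁, …, x_k ∈ B. -/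
open scoped symmDiff

/-- Finite meets are local: below `a` they depend only on the traces `a ⊓ x i`. -/
theorem inf_finsetInf_congr {B ι : Type*} [BooleanAlgebra B] {a : B} {x y : ι → B}
    (h : ∀ i, a ⊓ x i = a ⊓ y i) (s : Finset ι) : a ⊓ s.inf x = a ⊓ s.inf y := by
  classical
  induction s using Finset.induction_on with
  | empty => simp
  | insert i s _ ih =>
    rw [Finset.inf_insert, Finset.inf_insert, inf_inf_distrib_left, h i, ih,
      ← inf_inf_distrib_left]

/-- Term functions are local: below `a` they depend only on the traces `a ⊓ x i`. -/
theorem inf_termFun_congr {B : Type*} [BooleanAlgebra B] {k : ℕ} (S : Finset (Finset (Fin k)))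
    {a : B} {x y : Fin k → B} (h : ∀ i, a ⊓ x i = a ⊓ y i) :
    a ⊓ termFun S x = a ⊓ termFun S y := by
  unfold termFun
  induction S using Finset.induction_on with
  | empty => simp
  | insert ε S hε ih =>
    rw [Finset.fold_insert hε, Finset.fold_insert hε, inf_symmDiff_distrib_left,
      inf_finsetInf_congr h ε, ih, ← inf_symmDiff_distrib_left]

/-- If a term function `f` of the countable atomless Boolean algebra `B` commutes with the
translation by `1 = ⊤` (i.e. `f(x₁+1,…,x_k+1) = f(x₁,…,x_k)+1`, where `+` is symmetric
difference), then it commutes with every translation: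
`f(x₁+c,…,x_k+c) = f(x₁,…,x_k)+c` for all `c`. -/
theorem termFun_commutes_with_all_translations_of_top
    (B : Type*) [BooleanAlgebra B] [Countable B] [Nontrivial B] (hAtomless : Atomless B)
    {k : ℕ} (f : (Fin k → B) → B)
    (hterm : ∃ S : Finset (Finset (Fin k)), ∀ x, f x = termFun S x)
    (htop : ∀ x : Fin k → B, f (fun i => x i ∆ ⊤) = f x ∆ ⊤) :
    ∀ (c : B) (x : Fin k → B), f (fun i => x i ∆ c) = f x ∆ c := by
  obtain ⟨S, hS⟩ := hterm
  intro c x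
  have inf_symmDiff_self (z : B) : c ⊓ (z ∆ c) = c ⊓ (z ∆ ⊤) := by
    simp only [inf_symmDiff_distrib_left, inf_idem, inf_top_eq]
  have compl_inf_symmDiff_self (z : B) : cᶜ ⊓ (z ∆ c) = cᶜ ⊓ z := by
    simp only [inf_symmDiff_distrib_left, compl_inf_self, symmDiff_bot]
  have on_c : c ⊓ f (fun i => x i ∆ c) = c ⊓ (f x ∆ c) := by
    rw [inf_symmDiff_self, ← htop, hS, hS]
    exact inf_termFun_congr S fun i => inf_symmDiff_self (x i)
  have on_compl : cᶜ ⊓ f (fun i => x i ∆ c) = cᶜ ⊓ (f x ∆ c) := by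
    rw [compl_inf_symmDiff_self, hS, hS]
    exact inf_termFun_congr S fun i => compl_inf_symmDiff_self (x i)
  rw [← top_inf_eq (f fun i => x i ∆ c), ← top_inf_eq (f x ∆ c), ← sup_compl_eq_top (x := c),
    inf_sup_right, inf_sup_right, on_c, on_compl]
end

section
/- Let a, b ∈ B with a ∉ {0, 1} and b ∉ {0, 1}. Then there exists a Boolean automorphism σ of B with σ(a) = b. In particular, the group of Boolean automorphisms of B has exactly three orbits on B, namely {0}, {1} and B ∖ {0, 1}. -/
open scoped symmDiff

open Order

section BackAndForth

variable {α β : Type*} [BooleanAlgebra α] [BooleanAlgebra β]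

/-- A finite partition of the unit of `α × β` whose parts are nonzero in both coordinates. It matches
the atoms of a finite subalgebra of `α` with those of a finite subalgebra of `β`, that is, it encodes
an isomorphism between these subalgebras. -/
abbrev PartialBoolIso (α β : Type*) [BooleanAlgebra α] [BooleanAlgebra β] : Type _ :=
  {P : Finpartition (⊤ : α × β) // ∀ p ∈ P.parts, p.1 ≠ ⊥ ∧ p.2 ≠ ⊥}

/-- The pair `z` belongs to the graph of the partial isomorphism given by `P`: it is a join of
parts of `P`. -/
def Finpartition.Decides (P : Finpartition (⊤ : α × β)) (z : α × β) : Prop :=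
  ∀ p ∈ P.parts, p ≤ z ∨ p ≤ zᶜ

namespace Finpartition

theorem Decides.mono {P Q : Finpartition (⊤ : α × β)} {z : α × β} (h : Q.Decides z)
    (hPQ : P ≤ Q) : P.Decides z := by
  intro p hp
  obtain ⟨q, hq, hpq⟩ := hPQ hp
  exact (h q hq).imp hpq.trans hpq.trans

theorem Decides.compl {P : Finpartition (⊤ : α × β)} {z : α × β} (h : P.Decides z) :
    P.Decides zᶜ := by
  intro p hp
  rw [compl_compl]
  exact (h p hp).symm

theorem Decides.inf {P : Finpartition (⊤ : α × β)} {z w : α × β} (hz : P.Decides z)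
    (hw : P.Decides w) : P.Decides (z ⊓ w) := by
  intro p hp
  rw [compl_inf]
  rcases hz p hp with h | h
  · rcases hw p hp with h' | h'
    · exact Or.inl (le_inf h h')
    · exact Or.inr (le_sup_of_le_right h')
  · exact Or.inr (le_sup_of_le_left h)

theorem eq_bot_of_forall_le_compl {P : Finpartition (⊤ : α × β)} {z : α × β}
    (h : ∀ p ∈ P.parts, p ≤ zᶜ) : z = ⊥ := by
  rw [← compl_eq_top, eq_top_iff, ← P.sup_parts]
  exact Finset.sup_le h

/-- If every part of `P` is decided by `x` in the first coordinate, then `x` lies in the domain of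
the partial isomorphism given by `P`. -/
theorem exists_decides_of_fst {P : Finpartition (⊤ : α × β)} {x : α}
    (h : ∀ p ∈ P.parts, p.1 ≤ x ∨ p.1 ≤ xᶜ) : ∃ z : α × β, z.1 = x ∧ P.Decides z := by
  classical
  set z := (P.parts.filter fun p => p.1 ≤ x).sup id
  have hle : ∀ p ∈ P.parts, p.1 ≤ x → p ≤ z := fun p hp hpx =>
    Finset.le_sup (f := id) (Finset.mem_filter.2 ⟨hp, hpx⟩)
  refine ⟨z, le_antisymm ?_ ?_, fun p hp => ?_⟩
  · have : z ≤ (x, ⊤) := Finset.sup_le fun p hp => ⟨(Finset.mem_filter.1 hp).2, le_top⟩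
    exact this.1
  · have : (⊤ : α × β) ≤ z ⊔ (xᶜ, ⊤) := by
      rw [← P.sup_parts]
      refine Finset.sup_le fun p hp => ?_
      rcases h p hp with hpx | hpx
      · exact le_sup_of_le_left (hle p hp hpx)
      · exact le_sup_of_le_right ⟨hpx, le_top⟩
    have h1 : ⊤ ≤ z.1 ⊔ xᶜ := this.1
    rwa [← himp_eq, top_le_iff, himp_eq_top_iff] at h1
  · by_cases hpx : p.1 ≤ x
    · exact Or.inl (hle p hp hpx)
    · refine Or.inr (le_compl_iff_disjoint_right.2 ?_)
      refine Finset.disjoint_sup_right.2 fun q hq => ?_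
      obtain ⟨hq, hqx⟩ := Finset.mem_filter.1 hq
      exact P.disjoint hp hq (by rintro rfl; exact hpx hqx)

/-- A pair of nonzero elements can be partitioned so that `x` decides the first coordinates. -/
theorem exists_split_fst (hβ : Atomless β) (p : α × β) (hp : p.1 ≠ ⊥ ∧ p.2 ≠ ⊥) (x : α) :
    ∃ Q : Finpartition p, ∀ q ∈ Q.parts, (q.1 ≠ ⊥ ∧ q.2 ≠ ⊥) ∧ (q.1 ≤ x ∨ q.1 ≤ xᶜ) := by
  classical
  have hp0 : p ≠ ⊥ := fun h => hp.1 (by rw [h]; rfl)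
  by_cases h1 : p.1 ≤ x ∨ p.1 ≤ xᶜ
  · refine ⟨indiscrete hp0, fun q hq => ?_⟩
    obtain rfl : q = p := Finset.mem_singleton.1 hq
    exact ⟨hp, h1⟩
  · obtain ⟨hx, hxc⟩ := not_or.1 h1
    obtain ⟨w, hw0, hwp⟩ := hβ p.2 (bot_lt_iff_ne_bot.2 hp.2)
    have hu : p.1 ⊓ x ≠ ⊥ := fun h => hxc (le_compl_iff_disjoint_right.2 (disjoint_iff.2 h))
    have hv : p.1 \ x ≠ ⊥ := fun h => hx (sdiff_eq_bot_iff.1 h)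
    have hr : p.2 \ w ≠ ⊥ := fun h => hwp.not_ge (sdiff_eq_bot_iff.1 h)
    let Q : Finpartition p := (indiscrete (a := (p.1 ⊓ x, w))
        fun h => hu (congrArg Prod.fst h)).extend (b := (p.1 \ x, p.2 \ w))
      (fun h => hv (congrArg Prod.fst h))
      (Prod.disjoint_iff.2 ⟨disjoint_inf_sdiff, disjoint_sdiff_self_right⟩)
      (Prod.ext (sup_inf_sdiff _ _) (sup_sdiff_cancel_right hwp.le))
    refine ⟨Q, fun q hq => ?_⟩
    rcases Finset.mem_insert.1 hq with rfl | hq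
    · exact ⟨⟨hv, hr⟩, Or.inr (sdiff_eq (x := p.1) (y := x) ▸ inf_le_right)⟩
    · obtain rfl := Finset.mem_singleton.1 hq
      exact ⟨⟨hu, hw0.ne'⟩, Or.inl inf_le_right⟩

end Finpartition

namespace PartialBoolIso

theorem exists_le_decides_fst (hβ : Atomless β) (P : PartialBoolIso α β) (x : α) :
    ∃ Q ≤ P, ∃ z : α × β, z.1 = x ∧ Q.1.Decides z := by
  classical
  choose S hS using fun p hp => Finpartition.exists_split_fst hβ p (P.2 p hp) x
  have hQ : ∀ q ∈ (P.1.bind S).parts, (q.1 ≠ ⊥ ∧ q.2 ≠ ⊥) ∧ (q.1 ≤ x ∨ q.1 ≤ xᶜ) := by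
    intro q hq
    obtain ⟨p, hp, hq⟩ := Finpartition.mem_bind.1 hq
    exact hS p hp q hq
  refine ⟨⟨P.1.bind S, fun q hq => (hQ q hq).1⟩, fun q hq => ?_,
    Finpartition.exists_decides_of_fst fun q hq => (hQ q hq).2⟩
  obtain ⟨p, hp, hq⟩ := Finpartition.mem_bind.1 hq
  exact ⟨p, hp, (S p hp).le hq⟩

/-- The inverse of a partial isomorphism. -/
def swap (P : PartialBoolIso α β) : PartialBoolIso β α :=
  ⟨(P.1.map OrderIso.prodComm).copy rfl, by
    intro p hp
    obtain ⟨q, hq, rfl⟩ := Finset.mem_map.1 hp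
    exact (P.2 q hq).symm⟩

theorem mem_parts_swap {P : PartialBoolIso α β} {p : β × α} :
    p ∈ P.swap.1.parts ↔ p.swap ∈ P.1.parts := by
  constructor
  · intro hp
    obtain ⟨q, hq, rfl⟩ := Finset.mem_map.1 hp
    exact hq
  · intro hp
    exact Finset.mem_map.2 ⟨p.swap, hp, rfl⟩

theorem exists_le_decides_snd (hα : Atomless α) (P : PartialBoolIso α β) (y : β) :
    ∃ Q ≤ P, ∃ z : α × β, z.2 = y ∧ Q.1.Decides z := by
  obtain ⟨Q, hQP, z, hz, hQ⟩ := exists_le_decides_fst hα P.swap y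
  refine ⟨Q.swap, fun q hq => ?_, z.swap, hz, fun q hq => ?_⟩
  · obtain ⟨p, hp, hqp⟩ := hQP (mem_parts_swap.1 hq)
    exact ⟨p.swap, mem_parts_swap.1 hp, hqp.symm⟩
  · exact (hQ _ (mem_parts_swap.1 hq)).imp And.symm And.symm

theorem fst_eq_bot_iff {P : PartialBoolIso α β} {z : α × β} (h : P.1.Decides z) :
    z.1 = ⊥ ↔ z.2 = ⊥ := by
  constructor <;> intro hz
  · have : z = ⊥ := Finpartition.eq_bot_of_forall_le_compl fun p hp =>
      (h p hp).resolve_left fun hpz => (P.2 p hp).1 (le_bot_iff.1 (hpz.1.trans hz.le))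
    rw [this]; rfl
  · have : z = ⊥ := Finpartition.eq_bot_of_forall_le_compl fun p hp =>
      (h p hp).resolve_left fun hpz => (P.2 p hp).2 (le_bot_iff.1 (hpz.2.trans hz.le))
    rw [this]; rfl

/-- The partial isomorphism between the subalgebras generated by `a` and by `b` sending `a`
to `b`. -/
theorem exists_decides (a : α) (b : β) (ha : a ≠ ⊥ ∧ a ≠ ⊤) (hb : b ≠ ⊥ ∧ b ≠ ⊤) :
    ∃ P : PartialBoolIso α β, P.1.Decides (a, b) := by
  classical
  have hac : aᶜ ≠ ⊥ := fun h => ha.2 (compl_eq_bot.1 h)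
  have hbc : bᶜ ≠ ⊥ := fun h => hb.2 (compl_eq_bot.1 h)
  let P : Finpartition (⊤ : α × β) :=
    (Finpartition.indiscrete (a := (a, b)) fun h => ha.1 (congrArg Prod.fst h)).extend
      (b := (a, b)ᶜ) (fun h => hac (congrArg Prod.fst h)) disjoint_compl_right sup_compl_eq_top
  refine ⟨⟨P, fun p hp => ?_⟩, fun p hp => ?_⟩ <;>
    rcases Finset.mem_insert.1 hp with rfl | hp
  · exact ⟨hac, hbc⟩
  · obtain rfl := Finset.mem_singleton.1 hp
    exact ⟨ha.1, hb.1⟩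
  · exact Or.inr le_rfl
  · obtain rfl := Finset.mem_singleton.1 hp
    exact Or.inl le_rfl

/-- **Back-and-forth**: the graph of an isomorphism extending a given partial one. -/
theorem exists_graph [Countable α] [Countable β] (hα : Atomless α) (hβ : Atomless β)
    (P : PartialBoolIso α β) :
    ∃ R : Set (α × β), (∀ z, P.1.Decides z → z ∈ R) ∧ (∀ x, ∃ y, (x, y) ∈ R) ∧
      (∀ y, ∃ x, (x, y) ∈ R) ∧ (∀ z ∈ R, zᶜ ∈ R) ∧ (∀ z ∈ R, ∀ w ∈ R, z ⊓ w ∈ R) ∧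
      ∀ z ∈ R, (z.1 = ⊥ ↔ z.2 = ⊥) := by
  have := Encodable.ofCountable (α ⊕ β)
  let D : α ⊕ β → Cofinal (PartialBoolIso α β)ᵒᵈ := Sum.elim
    (fun x => ⟨{Q | ∃ z : α × β, z.1 = x ∧ (OrderDual.ofDual Q).1.Decides z}, fun Q =>
      let ⟨Q', h, hz⟩ := exists_le_decides_fst hβ (OrderDual.ofDual Q) x
      ⟨OrderDual.toDual Q', hz, h⟩⟩)
    (fun y => ⟨{Q | ∃ z : α × β, z.2 = y ∧ (OrderDual.ofDual Q).1.Decides z}, fun Q =>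
      let ⟨Q', h, hz⟩ := exists_le_decides_snd hα (OrderDual.ofDual Q) y
      ⟨OrderDual.toDual Q', hz, h⟩⟩)
  let I := idealOfCofinals (OrderDual.toDual P) D
  refine ⟨{z | ∃ Q ∈ I, (OrderDual.ofDual Q).1.Decides z},
    fun z hz => ⟨_, mem_idealOfCofinals _ D, hz⟩, fun x => ?_, fun y => ?_, ?_, ?_, ?_⟩
  · obtain ⟨Q, ⟨z, rfl, hz⟩, hQ⟩ := cofinal_meets_idealOfCofinals (OrderDual.toDual P) D (.inl x)
    exact ⟨z.2, Q, hQ, hz⟩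
  · obtain ⟨Q, ⟨z, rfl, hz⟩, hQ⟩ := cofinal_meets_idealOfCofinals (OrderDual.toDual P) D (.inr y)
    exact ⟨z.1, Q, hQ, hz⟩
  · rintro z ⟨Q, hQ, hz⟩
    exact ⟨Q, hQ, hz.compl⟩
  · rintro z ⟨Q, hQ, hz⟩ w ⟨Q', hQ', hw⟩
    obtain ⟨S, hS, hQS, hQS'⟩ := I.directed Q hQ Q' hQ'
    exact ⟨S, hS, (hz.mono hQS).inf (hw.mono hQS')⟩
  · rintro z ⟨Q, hQ, hz⟩
    exact fst_eq_bot_iff hz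

end PartialBoolIso

end BackAndForth

/-- A total and surjective relation on a Boolean algebra that is compatible with the operations and
matches `⊥` only with `⊥` is the graph of an automorphism. -/
theorem exists_isBoolAut_of_graph {B : Type*} [BooleanAlgebra B] {R : Set (B × B)}
    (hl : ∀ x, ∃ y, (x, y) ∈ R) (hr : ∀ y, ∃ x, (x, y) ∈ R) (hc : ∀ z ∈ R, zᶜ ∈ R)
    (hi : ∀ z ∈ R, ∀ w ∈ R, z ⊓ w ∈ R) (hbot : ∀ z ∈ R, (z.1 = ⊥ ↔ z.2 = ⊥)) :
    ∃ σ : B → B, IsBoolAut σ ∧ ∀ z ∈ R, σ z.1 = z.2 := by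
  have hle : ∀ z ∈ R, ∀ w ∈ R, (z.1 ≤ w.1 ↔ z.2 ≤ w.2) := by
    intro z hz w hw
    rw [← sdiff_eq_bot_iff, ← sdiff_eq_bot_iff, sdiff_eq, sdiff_eq]
    exact hbot _ (hi z hz _ (hc w hw))
  choose σ hσ using hl
  have hσR : ∀ z ∈ R, σ z.1 = z.2 := fun z hz =>
    le_antisymm ((hle _ (hσ z.1) z hz).1 le_rfl) ((hle z hz _ (hσ z.1)).1 le_rfl)
  have hcompl : ∀ x, σ xᶜ = (σ x)ᶜ := fun x => hσR _ (hc _ (hσ x))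
  have hinf : ∀ x y, σ (x ⊓ y) = σ x ⊓ σ y := fun x y => hσR _ (hi _ (hσ x) _ (hσ y))
  refine ⟨σ, ⟨⟨fun x y h => ?_, fun y => ?_⟩, hinf, fun x y => ?_, hcompl⟩, hσR⟩
  · exact le_antisymm ((hle _ (hσ x) _ (hσ y)).2 h.le) ((hle _ (hσ y) _ (hσ x)).2 h.ge)
  · obtain ⟨x, hx⟩ := hr y
    exact ⟨x, hσR _ hx⟩
  · rw [← compl_inj_iff, ← hcompl, compl_sup, hinf, hcompl, hcompl, compl_sup]

theorem IsBoolAut.map_bot {B : Type*} [BooleanAlgebra B] {σ : B → B} (h : IsBoolAut σ) :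
    σ ⊥ = ⊥ := by
  rw [← inf_compl_eq_bot (a := (⊥ : B)), h.2.1, h.2.2.2, inf_compl_eq_bot, inf_compl_eq_bot]

theorem IsBoolAut.map_top {B : Type*} [BooleanAlgebra B] {σ : B → B} (h : IsBoolAut σ) :
    σ ⊤ = ⊤ := by
  rw [← compl_bot, h.2.2.2, h.map_bot]

/-- The automorphism group of the countable atomless Boolean algebra `B` acts transitively
on `B ∖ {0, 1}`; since every Boolean automorphism fixes `0 = ⊥` and `1 = ⊤`, its orbits on
`B` are exactly `{0}`, `{1}` and `B ∖ {0, 1}`. -/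
theorem autB_transitive_off_bot_top
    (B : Type*) [BooleanAlgebra B] [Countable B] [Nontrivial B] (hAtomless : Atomless B)
    (a b : B) (ha : a ≠ ⊥ ∧ a ≠ ⊤) (hb : b ≠ ⊥ ∧ b ≠ ⊤) :
    (∃ σ : B → B, IsBoolAut σ ∧ σ a = b) ∧
      ∀ σ : B → B, IsBoolAut σ → σ ⊥ = ⊥ ∧ σ ⊤ = ⊤ := by
  refine ⟨?_, fun σ hσ => ⟨hσ.map_bot, hσ.map_top⟩⟩
  obtain ⟨P, hP⟩ := PartialBoolIso.exists_decides a b ha hb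
  obtain ⟨R, hPR, hl, hr, hc, hi, hbot⟩ := P.exists_graph hAtomless hAtomless
  obtain ⟨σ, hσ, hσR⟩ := exists_isBoolAut_of_graph hl hr hc hi hbot
  exact ⟨σ, hσ, hσR _ (hPR _ hP)⟩
end

section
/- Let α ∈ {0, 1} ⊆ B, let k ≥ 2, and let l : Bᵏ → B be the linear term function l(x₁,…,x_k) = x₁ + x₂ + ⋯ + x_k + α. If k is even, then a bijection φ : B → B preserves l if and only if it preserves the binary function f(x, y) = x + y + α. If k is odd, then a bijection φ : B → B preserves l if and only if it preserves the ternary function g(x, y, z) = x + y + z + α. -/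
open scoped symmDiff

/-- The sum `x₁ + x₂ + ⋯ + x_k` in the Boolean ring `B`, i.e. the iterated symmetric
difference of `x₁, …, x_k`. -/
def sumFin {B : Type*} [BooleanAlgebra B] {k : ℕ} (x : Fin k → B) : B :=
  Finset.univ.fold (· ∆ ·) ⊥ x

theorem sumFin_zero {B : Type*} [BooleanAlgebra B] (x : Fin 0 → B) : sumFin x = ⊥ := by
  simp [sumFin]

theorem sumFin_succ {B : Type*} [BooleanAlgebra B] {n : ℕ} (x : Fin (n + 1) → B) :
    sumFin x = x 0 ∆ sumFin fun i => x i.succ := by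
  simp only [sumFin, Fin.univ_succ, Finset.fold_cons, Finset.fold_map]
  rfl

/-- `φ` preserves the `n`-ary linear term function `x₁ + ⋯ + xₙ + α`. -/
def PreservesLinear {B : Type*} [BooleanAlgebra B] (φ : B → B) (α : B) (n : ℕ) : Prop :=
  Preserves φ fun x : Fin n → B => sumFin x ∆ α

namespace PreservesLinear

variable {B : Type*} [BooleanAlgebra B] {φ : B → B} {α : B} {n : ℕ}

/-- Substituting equal arguments for two variables cancels them. -/
theorem of_add_two (h : PreservesLinear φ α (n + 2)) : PreservesLinear φ α n := by
  intro x
  have := h (Fin.cons ⊥ (Fin.cons ⊥ x))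
  simpa only [sumFin_succ, Fin.cons_zero, Fin.cons_succ, symmDiff_symmDiff_cancel_left] using this

theorem add_two (h3 : ∀ x y z : B, φ (x ∆ (y ∆ z)) = φ x ∆ (φ y ∆ φ z))
    (h : PreservesLinear φ α n) : PreservesLinear φ α (n + 2) := by
  intro x
  have hx := h fun i => x i.succ.succ
  dsimp only at hx ⊢
  simp only [sumFin_succ, symmDiff_assoc, h3, hx]

theorem of_add_two_mul (m : ℕ) (h : PreservesLinear φ α (n + 2 * m)) :
    PreservesLinear φ α n := by
  induction m with
  | zero => exact h
  | succ m ih => exact ih (of_add_two h)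

theorem add_two_mul (h3 : ∀ x y z : B, φ (x ∆ (y ∆ z)) = φ x ∆ (φ y ∆ φ z)) (m : ℕ)
    (h : PreservesLinear φ α n) : PreservesLinear φ α (n + 2 * m) := by
  induction m with
  | zero => exact h
  | succ m ih => exact add_two h3 ih

theorem two_iff :
    PreservesLinear φ α 2 ↔ ∀ x y : B, φ (x ∆ (y ∆ α)) = φ x ∆ (φ y ∆ α) := by
  constructor
  · intro h x y
    simpa [sumFin_succ, sumFin_zero, symmDiff_assoc] using h ![x, y]
  · intro h x
    simp [sumFin_succ, sumFin_zero, symmDiff_assoc, h]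

theorem three_iff :
    PreservesLinear φ α 3 ↔
      ∀ x y z : B, φ (x ∆ (y ∆ (z ∆ α))) = φ x ∆ (φ y ∆ (φ z ∆ α)) := by
  constructor
  · intro h x y z
    simpa [sumFin_succ, sumFin_zero, symmDiff_assoc] using h ![x, y, z]
  · intro h x
    simp [sumFin_succ, sumFin_zero, symmDiff_assoc, h]

end PreservesLinear

theorem map_symmDiff_three_of_binary {B : Type*} [BooleanAlgebra B] {φ : B → B} {α : B}
    (h : ∀ x y : B, φ (x ∆ (y ∆ α)) = φ x ∆ (φ y ∆ α)) (x y z : B) :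
    φ (x ∆ (y ∆ z)) = φ x ∆ (φ y ∆ φ z) := by
  have key := h x (y ∆ (z ∆ α))
  rw [h y z] at key
  simpa only [symmDiff_assoc, symmDiff_self, symmDiff_bot] using key

theorem map_symmDiff_three_of_ternary {B : Type*} [BooleanAlgebra B] {φ : B → B} {α : B}
    (h : ∀ x y z : B, φ (x ∆ (y ∆ (z ∆ α))) = φ x ∆ (φ y ∆ (φ z ∆ α))) (x y z : B) :
    φ (x ∆ (y ∆ z)) = φ x ∆ (φ y ∆ φ z) := by
  have translate : φ (z ∆ α) = φ z ∆ α := by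
    simpa only [symmDiff_symmDiff_cancel_left] using h ⊥ ⊥ z
  have key := h x y (z ∆ α)
  rw [translate] at key
  simpa only [symmDiff_assoc, symmDiff_self, symmDiff_bot] using key

/-- In the countable atomless Boolean algebra `B` (viewed as a Boolean ring, `+` being
symmetric difference, `0 = ⊥`, `1 = ⊤`), let `α ∈ {0,1}` and `k ≥ 2`, and let
`l(x₁,…,x_k) = x₁ + ⋯ + x_k + α`. If `k` is even, a bijection preserves `l` iff it
preserves `f(x,y) = x + y + α`; if `k` is odd, a bijection preserves `l` iff it preserves
`g(x,y,z) = x + y + z + α`. -/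
theorem linear_term_interdefinable_with_canonical
    (B : Type*) [BooleanAlgebra B] [Countable B] [Nontrivial B] (hAtomless : Atomless B)
    (α : B) (hα : α = ⊥ ∨ α = ⊤) (k : ℕ) (hk : 2 ≤ k)
    (l : (Fin k → B) → B)
    (hl : ∀ x : Fin k → B, l x = sumFin x ∆ α)
    (φ : B → B) (hbij : Function.Bijective φ) :
    (Even k → (Preserves φ l ↔ ∀ x y : B, φ (x ∆ (y ∆ α)) = φ x ∆ (φ y ∆ α))) ∧
    (Odd k → (Preserves φ l ↔
      ∀ x y z : B, φ (x ∆ (y ∆ (z ∆ α))) = φ x ∆ (φ y ∆ (φ z ∆ α)))) := by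
  have hP : Preserves φ l ↔ PreservesLinear φ α k := by
    rw [PreservesLinear, funext hl]
  rw [hP]
  refine ⟨fun heven => ?_, fun hodd => ?_⟩
  · obtain ⟨m, rfl⟩ : ∃ m, k = 2 + 2 * m := by
      obtain ⟨r, rfl⟩ := heven
      exact ⟨r - 1, by omega⟩
    rw [← PreservesLinear.two_iff]
    exact ⟨PreservesLinear.of_add_two_mul m, fun h =>
      h.add_two_mul (map_symmDiff_three_of_binary (PreservesLinear.two_iff.1 h)) m⟩
  · obtain ⟨m, rfl⟩ : ∃ m, k = 3 + 2 * m := by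
      obtain ⟨r, rfl⟩ := hodd
      exact ⟨r - 1, by omega⟩
    rw [← PreservesLinear.three_iff]
    exact ⟨PreservesLinear.of_add_two_mul m, fun h =>
      h.add_two_mul (map_symmDiff_three_of_ternary (PreservesLinear.three_iff.1 h)) m⟩
end

section
/- Consider the following four subgroups of the symmetric group on B: Aut(0) = {φ : φ(0) = 0}, Aut(1) = {φ : φ(1) = 1}, Aut(Σ) = {φ : φ preserves Σ(x, y, z) = x + y + z}, and Aut(¬) = {φ : φ(¬x) = ¬φ(x) for all x}. These four groups form an antichain under inclusion: none of them is contained in any other. -/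
open scoped symmDiff

section BooleanAlgebra

variable {B : Type*} [BooleanAlgebra B]

lemma symmDiff_top_eq_compl (a : B) : a ∆ ⊤ = aᶜ := by simp

lemma compl_symmDiff_eq_symmDiff_compl (x a : B) : xᶜ ∆ a = (x ∆ a)ᶜ := by
  rw [← symmDiff_top_eq_compl, ← symmDiff_top_eq_compl, symmDiff_right_comm]

/-- Translation `x ↦ x ∆ a` as a permutation. -/
def symmDiffPerm (a : B) : Equiv.Perm B :=
  (symmDiff_left_involutive a).toPerm

lemma symmDiffPerm_apply (a x : B) : symmDiffPerm a x = x ∆ a := rfl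

lemma symmDiffPerm_sum (a x y z : B) :
    symmDiffPerm a (x ∆ (y ∆ z)) =
      symmDiffPerm a x ∆ (symmDiffPerm a y ∆ symmDiffPerm a z) := by
  simp only [symmDiffPerm_apply]
  rw [symmDiff_symmDiff_symmDiff_comm y a z a, symmDiff_self, symmDiff_bot, symmDiff_right_comm]

/-- Membership in a prime ideal is the kernel of an additive map to the two-element group. -/
lemma Order.Ideal.IsPrime.symmDiff_mem_iff {I : Order.Ideal B} (hI : I.IsPrime) (x y : B) :
    x ∆ y ∈ I ↔ (x ∈ I ↔ y ∈ I) := by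
  have h_mem : ∀ u v : B, u ∈ I → v ∈ I → u ∆ v ∈ I := fun u v hu hv =>
    I.lower symmDiff_le_sup (Order.Ideal.sup_mem hu hv)
  have h_not_top : (⊤ : B) ∉ I := hI.toIsProper.top_notMem
  have h_compl : ∀ u : B, u ∉ I → uᶜ ∈ I := fun u hu => hI.mem_or_compl_mem.resolve_left hu
  constructor
  · intro h
    constructor
    · intro hx
      simpa using h_mem _ _ hx h
    · intro hy
      simpa using h_mem _ _ h hy
  · intro h
    by_cases hx : x ∈ I
    · exact h_mem _ _ hx (h.1 hx)
    · have hy : y ∉ I := fun hy => hx (h.2 hy)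
      simpa using h_mem _ _ (h_compl x hx) (h_compl y hy)

open Classical in
/-- The additive transvection fixing a prime ideal pointwise and translating its complement. -/
noncomputable def transvection {I : Order.Ideal B} (hI : I.IsPrime) {a : B} (ha : a ∈ I) :
    Equiv.Perm B :=
  Function.Involutive.toPerm (fun x => if x ∈ I then x else x ∆ a) fun x => by
    by_cases hx : x ∈ I
    · simp [hx]
    · have hxa : x ∆ a ∉ I := by simp [hI.symmDiff_mem_iff, hx, ha]
      simp [hx, hxa]

open Classical in
lemma transvection_apply {I : Order.Ideal B} (hI : I.IsPrime) {a : B} (ha : a ∈ I) (x : B) :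
    transvection hI ha x = if x ∈ I then x else x ∆ a := rfl

lemma transvection_symmDiff {I : Order.Ideal B} (hI : I.IsPrime) {a : B} (ha : a ∈ I) (x y : B) :
    transvection hI ha (x ∆ y) = transvection hI ha x ∆ transvection hI ha y := by
  have h_mem := hI.symmDiff_mem_iff x y
  simp only [transvection_apply]
  by_cases hx : x ∈ I <;> by_cases hy : y ∈ I <;> simp only [hx, hy] at h_mem <;>
    simp only [hx, hy, h_mem, if_true, if_false]
  · exact symmDiff_assoc x y a
  · exact symmDiff_right_comm x y a
  · rw [symmDiff_symmDiff_symmDiff_comm, symmDiff_self, symmDiff_bot]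

lemma exists_isPrime_mem_of_ne_top {a : B} (ha : a ≠ ⊤) :
    ∃ I : Order.Ideal B, I.IsPrime ∧ a ∈ I := by
  have h_disj : Disjoint (Order.PFilter.principal (⊤ : B) : Set B) (Order.Ideal.principal a) := by
    rw [Set.disjoint_left]
    intro x hx hxa
    exact ha (top_le_iff.1 ((Order.PFilter.mem_principal.1 hx).trans
      (Order.Ideal.mem_principal.1 hxa)))
  obtain ⟨I, hI, hle, -⟩ := DistribLattice.prime_ideal_of_disjoint_filter_ideal h_disj
  exact ⟨I, hI, hle (Order.Ideal.mem_principal.2 le_rfl)⟩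

open Classical in
lemma swap_compl_apply_compl (a x : B) :
    Equiv.swap a aᶜ xᶜ = (Equiv.swap a aᶜ x)ᶜ := by
  by_cases h : x = a
  · simp [h]
  by_cases h' : x = aᶜ
  · simp [h']
  rw [Equiv.swap_apply_of_ne_of_ne h h', Equiv.swap_apply_of_ne_of_ne _ (by simpa using h)]
  exact fun hx => h' (by rw [← hx, compl_compl])

end BooleanAlgebra

/-- In the symmetric group of the countable atomless Boolean algebra `B` (viewed as a
Boolean ring, `+` being symmetric difference, `0 = ⊥`, `1 = ⊤`), the four groups
`Aut(0)` (stabilizer of `0`), `Aut(1)` (stabilizer of `1`), `Aut(Σ)` (permutations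
preserving `Σ(x,y,z) = x + y + z`) and `Aut(¬)` (complement-preserving permutations)
form an antichain under inclusion: none is contained in any other. -/
theorem four_coatoms_form_antichain
    (B : Type*) [BooleanAlgebra B] [Countable B] [Nontrivial B] (hAtomless : Atomless B) :
    let G0 : Set (Equiv.Perm B) := {φ : Equiv.Perm B | φ ⊥ = ⊥}
    let G1 : Set (Equiv.Perm B) := {φ : Equiv.Perm B | φ ⊤ = ⊤}
    let GS : Set (Equiv.Perm B) :=
      {φ : Equiv.Perm B | ∀ x y z, φ (x ∆ (y ∆ z)) = φ x ∆ (φ y ∆ φ z)}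
    let GN : Set (Equiv.Perm B) := {φ : Equiv.Perm B | ∀ x, φ xᶜ = (φ x)ᶜ}
    ¬G0 ⊆ G1 ∧ ¬G0 ⊆ GS ∧ ¬G0 ⊆ GN ∧
    ¬G1 ⊆ G0 ∧ ¬G1 ⊆ GS ∧ ¬G1 ⊆ GN ∧
    ¬GS ⊆ G0 ∧ ¬GS ⊆ G1 ∧ ¬GS ⊆ GN ∧
    ¬GN ⊆ G0 ∧ ¬GN ⊆ G1 ∧ ¬GN ⊆ GS := by
  classical
  intro G0 G1 GS GN
  obtain ⟨a, ha0, ha1⟩ := hAtomless ⊤ bot_lt_top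
  obtain ⟨b, hb0, hba⟩ := hAtomless a ha0
  have hb_compl : b ≠ aᶜ := fun h => hb0.ne' (disjoint_self.1
    (Disjoint.mono hba.le h.le disjoint_compl_right))
  have hb_compl' : bᶜ ≠ a := fun h => hb_compl (by rw [← h, compl_compl])
  have hb1 : b ≠ ⊤ := (hba.trans ha1).ne
  have h_bot_ne : (⊥ : B) ≠ ⊤ := bot_ne_top
  have h_swap_top : Equiv.swap ⊤ a ∈ G0 :=
    Equiv.swap_apply_of_ne_of_ne h_bot_ne ha0.ne
  have h_swap_bot : Equiv.swap ⊥ a ∈ G1 :=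
    Equiv.swap_apply_of_ne_of_ne h_bot_ne.symm ha1.ne'
  have h_trans_sum : symmDiffPerm a ∈ GS := symmDiffPerm_sum a
  have h_trans_compl : symmDiffPerm a ∈ GN := fun x => compl_symmDiff_eq_symmDiff_compl x a
  have h_trans_bot : symmDiffPerm a ∉ G0 := fun h => ha0.ne' (by
    simpa [G0, symmDiffPerm_apply] using h)
  have h_trans_top : symmDiffPerm a ∉ G1 := fun h => ha0.ne' (by
    simpa [G1, symmDiffPerm_apply] using h)
  refine ⟨fun h => ?_, fun h => ?_, fun h => ?_, fun h => ?_, fun h => ?_, fun h => ?_,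
    fun h => h_trans_bot (h h_trans_sum), fun h => h_trans_top (h h_trans_sum), fun h => ?_,
    fun h => h_trans_bot (h h_trans_compl), fun h => h_trans_top (h h_trans_compl), fun h => ?_⟩
  · exact ha1.ne (by simpa [G1] using h h_swap_top)
  · have key := h h_swap_top b bᶜ ⊥
    rw [Equiv.swap_apply_of_ne_of_ne hb1 hba.ne,
      Equiv.swap_apply_of_ne_of_ne (by simpa using hb0.ne') hb_compl',
      Equiv.swap_apply_of_ne_of_ne h_bot_ne ha0.ne] at key
    exact ha1.ne (by simpa using key)
  · have key := h h_swap_top ⊥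
    rw [Equiv.swap_apply_of_ne_of_ne h_bot_ne ha0.ne] at key
    exact ha1.ne (by simpa using key)
  · exact ha0.ne' (by simpa [G0] using h h_swap_bot)
  · have key := h h_swap_bot b bᶜ ⊤
    rw [Equiv.swap_apply_of_ne_of_ne hb0.ne' hba.ne,
      Equiv.swap_apply_of_ne_of_ne (by simpa using hb1) hb_compl',
      Equiv.swap_apply_of_ne_of_ne h_bot_ne.symm ha1.ne'] at key
    exact ha0.ne' (by simpa using key)
  · have key := h h_swap_bot ⊤
    rw [Equiv.swap_apply_of_ne_of_ne h_bot_ne.symm ha1.ne'] at key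
    exact ha0.ne' (by simpa using key)
  · obtain ⟨I, hI, haI⟩ := exists_isPrime_mem_of_ne_top ha1.ne
    have h_mem : transvection hI haI ∈ GS := fun x y z => by
      rw [transvection_symmDiff, transvection_symmDiff]
    have key := h h_mem ⊥
    have h_top : (⊤ : B) ∉ I := hI.toIsProper.top_notMem
    exact ha0.ne' (by simpa [transvection_apply, h_top] using key)
  · have key := h (show Equiv.swap a aᶜ ∈ GN from swap_compl_apply_compl a) b (a ∆ b) ⊥
    rw [Equiv.swap_apply_of_ne_of_ne hba.ne hb_compl,
      Equiv.swap_apply_of_ne_of_ne (x := a ∆ b) (by simpa using hb0.ne')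
        (by rwa [← symmDiff_top_eq_compl a, symmDiff_right_injective a |>.ne_iff]),
      Equiv.swap_apply_of_ne_of_ne ha0.ne (fun h => ha1.ne (compl_eq_bot.1 h.symm)),
      symmDiff_bot, symmDiff_comm a b, symmDiff_symmDiff_cancel_left] at key
    exact (ne_compl_self (a := a)) (by simpa using key.symm)
end

section
/- Every bijection φ : B → B that preserves the median M(x, y, z) = x·y + y·z + z·x also preserves Σ₁(x, y, z) = x + y + z + 1; that is, Aut(M) ≤ Aut(Σ₁). -/
open scoped symmDiff

/-- In a Boolean ring, `x + y + z` is a term in the median and the complement `t ↦ t + 1`: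
`x + y + z = M(M(x,y,z) + 1, M(x,y,z + 1), z)`. -/
theorem BooleanRing.add_add_eq_median {R : Type*} [BooleanRing R] (x y z : R) :
    x + (y + z) =
      (x * y + (y * z + z * x) + 1) * (x * y + (y * (z + 1) + (z + 1) * x)) +
        ((x * y + (y * (z + 1) + (z + 1) * x)) * z +
          z * (x * y + (y * z + z * x) + 1)) := by
  have hx := BooleanRing.mul_self x
  have hy := BooleanRing.mul_self y
  have hz := BooleanRing.mul_self z
  have htwo : (1 : R) + 1 = 0 := BooleanRing.add_self 1
  grind

theorem symmDiff_symmDiff_eq_median {B : Type*} [BooleanAlgebra B] (x y z : B) :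
    x ∆ (y ∆ z) = median (median x y z)ᶜ (median x y zᶜ) z := by
  rw [← hnot_eq_compl, ← hnot_eq_compl, ← symmDiff_top, ← symmDiff_top]
  exact BooleanRing.add_add_eq_median (R := AsBoolRing B) x y z

theorem median_compl_right {B : Type*} [BooleanAlgebra B] (x z : B) :
    median x xᶜ z = z := by
  rw [median, inf_compl_eq_bot, bot_symmDiff, inf_comm z x, inf_comm xᶜ z, inf_comm x z,
    ← inf_symmDiff_distrib_left, compl_symmDiff_self, inf_top_eq]

/-- Complements are determined by the median: `M(a,b,z) = z` for all `z` forces `b = aᶜ`. -/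
theorem eq_compl_of_median_eq {B : Type*} [BooleanAlgebra B] {a b : B}
    (h : ∀ z, median a b z = z) : b = aᶜ := by
  have hbot : a ⊓ b = ⊥ := by simpa [median] using h ⊥
  have htop : b ∆ a = ⊤ := by simpa [median, hbot] using h ⊤
  exact eq_compl_iff_isCompl.mpr ((symmDiff_eq_top _ _).mp htop)

/-- In the countable atomless Boolean algebra `B`, every bijection preserving the median
`M(x,y,z) = x·y + y·z + z·x` also preserves `Σ₁(x,y,z) = x + y + z + 1` (where `+` is
symmetric difference and `1 = ⊤`): `Aut(M) ≤ Aut(Σ₁)`. -/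
theorem preserves_median_imp_preserves_sum1
    (B : Type*) [BooleanAlgebra B] [Countable B] [Nontrivial B] (hAtomless : Atomless B)
    (φ : B → B) (hbij : Function.Bijective φ)
    (hM : ∀ x y z, φ (median x y z) = median (φ x) (φ y) (φ z)) :
    ∀ x y z, φ (x ∆ (y ∆ (z ∆ ⊤))) = φ x ∆ (φ y ∆ (φ z ∆ ⊤)) := by
  have hcompl (x : B) : φ xᶜ = (φ x)ᶜ := by
    refine eq_compl_of_median_eq fun w => ?_
    obtain ⟨z, rfl⟩ := hbij.surjective w
    rw [← hM, median_compl_right]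
  intro x y z
  simp only [symmDiff_top, hnot_eq_compl, symmDiff_symmDiff_eq_median, hM, hcompl]
end
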